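/- If X is a locally H-closed Hausdorff space, then |X| ≤ wL(X)^(ψ_c(X)·t(X)). -/

import Mathlib

open Cardinal Set

universe u

section Defs
variable (X : Type u) [TopologicalSpace X]

/-- An open cover of the whole space. -/
def IsOpenCover (𝒰 : Set (Set X)) : Prop := (∀ U ∈ 𝒰, IsOpen U) ∧ ⋃₀ 𝒰 = Set.univ

/-- The cellularity: supremum of cardinalities of pairwise disjoint families of nonempty
open sets, plus `ℵ₀`. -/
noncomputable def cellularity : Cardinal.{u} :=
  max ℵ₀ (⨆ 𝒰 : {𝒰 : Set (Set X) // (∀ U ∈ 𝒰, IsOpen U ∧ U.Nonempty) ∧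
    𝒰.PairwiseDisjoint id}, #𝒰.1)

/-- The weak Lindelöf degree. -/
noncomputable def wLdeg : Cardinal.{u} :=
  sInf {κ | ℵ₀ ≤ κ ∧ ∀ 𝒰 : Set (Set X), IsOpenCover X 𝒰 →
    ∃ 𝒱 ⊆ 𝒰, #𝒱 ≤ κ ∧ Dense (⋃₀ 𝒱)}

/-- The tightness. -/
noncomputable def tightness : Cardinal.{u} :=
  sInf {κ | ℵ₀ ≤ κ ∧ ∀ (A : Set X) (x : X), x ∈ closure A →
    ∃ B ⊆ A, #B ≤ κ ∧ x ∈ closure B}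

/-- The π-character. -/
noncomputable def piCharacter : Cardinal.{u} :=
  sInf {κ | ℵ₀ ≤ κ ∧ ∀ x : X, ∃ 𝒬 : Set (Set X), #𝒬 ≤ κ ∧
    (∀ P ∈ 𝒬, IsOpen P ∧ P.Nonempty) ∧
    ∀ U : Set X, IsOpen U → x ∈ U → ∃ P ∈ 𝒬, P ⊆ U}

/-- The pseudocharacter. -/
noncomputable def pseudoChar : Cardinal.{u} :=
  sInf {κ | ℵ₀ ≤ κ ∧ ∀ x : X, ∃ 𝒱 : Set (Set X), #𝒱 ≤ κ ∧
    (∀ V ∈ 𝒱, IsOpen V ∧ x ∈ V) ∧ ⋂₀ 𝒱 = {x}}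

/-- The closed pseudocharacter. -/
noncomputable def closedPseudoChar : Cardinal.{u} :=
  sInf {κ | ℵ₀ ≤ κ ∧ ∀ x : X, ∃ 𝒱 : Set (Set X), #𝒱 ≤ κ ∧
    (∀ V ∈ 𝒱, IsOpen V ∧ x ∈ V) ∧ (⋂ V ∈ 𝒱, closure V) = {x}}

/-- The density. -/
noncomputable def densityCard : Cardinal.{u} :=
  sInf {κ | ℵ₀ ≤ κ ∧ ∃ D : Set X, #D ≤ κ ∧ Dense D}

/-- The star of a set `A` with respect to a family `𝒰`. -/
def st (A : Set X) (𝒰 : Set (Set X)) : Set X := ⋃₀ {U | U ∈ 𝒰 ∧ (A ∩ U).Nonempty}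

/-- The θ-closure of a set. -/
def thetaClosure (A : Set X) : Set X :=
  {x | ∀ U : Set X, IsOpen U → x ∈ U → (closure U ∩ A).Nonempty}

/-- The θ-density. -/
noncomputable def thetaDensityCard : Cardinal.{u} :=
  sInf {κ | ℵ₀ ≤ κ ∧ ∃ D : Set X, #D ≤ κ ∧ thetaClosure X D = Set.univ}

/-- A discrete family of sets: each point has a neighborhood meeting at most one member. -/
def IsDiscreteFamily (𝒰 : Set (Set X)) : Prop :=
  ∀ x : X, ∃ V : Set X, IsOpen V ∧ x ∈ V ∧ {U | U ∈ 𝒰 ∧ (V ∩ U).Nonempty}.Subsingleton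

/-- Countable discrete cellularity. -/
def CDC : Prop :=
  ∀ 𝒰 : Set (Set X), (∀ U ∈ 𝒰, IsOpen U ∧ U.Nonempty) → IsDiscreteFamily X 𝒰 → 𝒰.Countable

/-- Star-cdc: every open cover has a cdc subspace whose star covers the space. -/
def StarCDC : Prop :=
  ∀ 𝒰 : Set (Set X), IsOpenCover X 𝒰 → ∃ Y : Set X, CDC ↥Y ∧ st X Y 𝒰 = Set.univ

/-- H-closed space: every open cover has a finite subfamily with dense union. -/
def IsHClosedSpace : Prop :=
  ∀ 𝒰 : Set (Set X), IsOpenCover X 𝒰 → ∃ 𝒱 ⊆ 𝒰, 𝒱.Finite ∧ Dense (⋃₀ 𝒱)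

/-- Countable cellularity (ccc). -/
def CCCSpace : Prop :=
  ∀ 𝒰 : Set (Set X), (∀ U ∈ 𝒰, IsOpen U ∧ U.Nonempty) → 𝒰.PairwiseDisjoint id → 𝒰.Countable

/-- Weakly Lindelöf space. -/
def WeaklyLindelof : Prop :=
  ∀ 𝒰 : Set (Set X), IsOpenCover X 𝒰 → ∃ 𝒱 ⊆ 𝒰, 𝒱.Countable ∧ Dense (⋃₀ 𝒱)

/-- Almost Lindelöf space. -/
def AlmostLindelof : Prop :=
  ∀ 𝒰 : Set (Set X), IsOpenCover X 𝒰 → ∃ 𝒱 ⊆ 𝒰, 𝒱.Countable ∧ (⋃ V ∈ 𝒱, closure V) = Set.univ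

/-- A π-base: a family of nonempty open sets such that every nonempty open set contains one. -/
def IsPiBase (ℬ : Set (Set X)) : Prop :=
  (∀ B ∈ ℬ, IsOpen B ∧ B.Nonempty) ∧
  ∀ U : Set X, IsOpen U → U.Nonempty → ∃ B ∈ ℬ, B ⊆ U

/-- Power homogeneous: some power of `X` is homogeneous. -/
def PowerHomogeneous : Prop :=
  ∃ ι : Type u, ∀ x y : ι → X, ∃ h : (ι → X) ≃ₜ (ι → X), h x = y

/-- A strong `G_δ`-diagonal of rank 2. -/
def HasStrongRank2Diagonal : Prop :=
  ∃ 𝒰 : ℕ → Set (Set X), (∀ n, IsOpenCover X (𝒰 n)) ∧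
    ∀ x : X, (⋂ n, closure (st X (st X {x} (𝒰 n)) (𝒰 n))) = {x}

/-- A `G_δ`-diagonal of rank 2. -/
def HasRank2Diagonal : Prop :=
  ∃ 𝒰 : ℕ → Set (Set X), (∀ n, IsOpenCover X (𝒰 n)) ∧
    ∀ x : X, (⋂ n, st X (st X {x} (𝒰 n)) (𝒰 n)) = {x}

/-- A `G_δ`-diagonal of rank 3. -/
def HasRank3Diagonal : Prop :=
  ∃ 𝒰 : ℕ → Set (Set X), (∀ n, IsOpenCover X (𝒰 n)) ∧
    ∀ x : X, (⋂ n, st X (st X (st X {x} (𝒰 n)) (𝒰 n)) (𝒰 n)) = {x}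

/-- Basically disconnected: the closure of every cozero set is open. -/
def BasicallyDisconnected : Prop :=
  ∀ f : C(X, ℝ), IsOpen (closure {x | f x ≠ 0})

end Defs

theorem exists_range_eq_of_mk_le {X J : Type u} {S : Set X} (hS : S.Nonempty) (h : #S ≤ #J) :
    ∃ g : J → X, range g = S := by
  obtain ⟨e⟩ := h
  have : Nonempty S := hS.to_subtype
  refine ⟨fun j => (Function.invFun e j : S), ?_⟩
  have hs := Function.invFun_surjective e.injective
  ext x
  constructor
  · rintro ⟨j, rfl⟩
    exact (Function.invFun e j).2
  · intro hx
    obtain ⟨j, hj⟩ := hs ⟨x, hx⟩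
    exact ⟨j, by simp [hj]⟩

/-- A nonempty set of size at most `2 ^ κ` closed under an operation that assigns sets of size
at most `2 ^ κ` to nonempty sets of size at most `κ`. -/
theorem exists_mk_le_two_power_closed {X I : Type u} [Nonempty X] [Infinite I]
    (T : Set X → Set X) (hT : ∀ S : Set X, #S ≤ #I → #(T S) ≤ 2 ^ #I) :
    ∃ H : Set X, H.Nonempty ∧ #H ≤ 2 ^ #I ∧
      ∀ S ⊆ H, S.Nonempty → #S ≤ #I → T S ⊆ H := by
  classical
  obtain ⟨x₀⟩ := ‹Nonempty X›
  have hI : ℵ₀ ≤ #I := aleph0_le_mk I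
  have hA : #(Set I) = 2 ^ #I := by simp
  have hg : ∀ f : I → X, ∃ g : Set I → X, T (range f) ⊆ range g := by
    intro f
    rcases (T (range f)).eq_empty_or_nonempty with h | h
    · exact ⟨fun _ => x₀, by simp [h]⟩
    · obtain ⟨g, hg⟩ := exists_range_eq_of_mk_le (J := Set I) h
        (by rw [hA]; exact hT _ mk_range_le)
      exact ⟨g, hg.ge⟩
  choose g hg using hg
  let β : Option (Set I) → Type u := fun o => o.elim PEmpty (fun _ => I)
  let ev : WType β → X := WType.elim X (fun s : Σ a : Option (Set I), β a → X =>
    match s with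
    | ⟨none, _⟩ => x₀
    | ⟨some a, f⟩ => g f a)
  have hev : ∀ (a : Set I) (f : I → WType β),
      ev (WType.mk (some a) f) = g (fun i => ev (f i)) a := fun a f => rfl
  refine ⟨range ev, ⟨_, ⟨WType.mk none PEmpty.elim, rfl⟩⟩, ?_, ?_⟩
  · refine mk_range_le.trans (WType.cardinalMk_le_of_le ?_)
    have h2 : ((2 : Cardinal.{u}) ^ #I) ^ #I = 2 ^ #I := by
      rw [← power_mul, mul_eq_self hI]
    have hle : ∀ a : Option (Set I), ((2 : Cardinal.{u}) ^ #I) ^ #(β a) ≤ 2 ^ #I := by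
      rintro (_ | a)
      · change _ ^ #PEmpty ≤ _
        simp only [mk_pempty, power_zero]
        exact one_le_aleph0.trans (hI.trans (cantor _).le)
      · exact h2.le
    have hinf : ℵ₀ ≤ (2 : Cardinal.{u}) ^ #I := hI.trans (cantor _).le
    calc _ ≤ sum (fun _ : Option (Set I) => (2 : Cardinal.{u}) ^ #I) := sum_le_sum _ _ hle
      _ = (2 ^ #I + 1) * 2 ^ #I := by rw [sum_const', mk_option, hA]
      _ ≤ 2 ^ #I := by
        rw [add_one_eq hinf, mul_eq_self hinf]
  · intro S hSH hS hSI x hx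
    obtain ⟨f, rfl⟩ := exists_range_eq_of_mk_le hS hSI
    have : ∀ i, ∃ w, ev w = f i := fun i => hSH ⟨i, rfl⟩
    choose w hw using this
    obtain ⟨a, rfl⟩ := hg f hx
    refine ⟨WType.mk (some a) w, ?_⟩
    rw [hev]
    simp only [hw]

theorem mk_finset_prod_fst_mem_le {X I : Type u} [Infinite I] {S : Set X} (hS : #S ≤ #I) :
    #{t : Finset (X × I) // ∀ p ∈ t, p.1 ∈ S} ≤ #I := by
  classical
  have hI : ℵ₀ ≤ #I := aleph0_le_mk I
  let e : S × I → X × I := fun p => (p.1, p.2)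
  have he : Function.Injective e := by
    rintro ⟨a, b⟩ ⟨c, d⟩ h
    simpa [e, Subtype.ext_iff] using h
  have h1 : #{t : Finset (X × I) // ∀ p ∈ t, p.1 ∈ S} ≤ #(Finset (S × I)) := by
    refine mk_le_of_surjective (f := fun t : Finset (S × I) => ⟨t.image e, ?_⟩) ?_
    · intro p hp
      obtain ⟨q, -, rfl⟩ := Finset.mem_image.1 hp
      exact q.1.2
    · rintro ⟨t, ht⟩
      refine ⟨t.preimage e he.injOn, Subtype.ext ?_⟩
      ext p
      simp only [Finset.mem_image, Finset.mem_preimage]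
      constructor
      · rintro ⟨q, hq, rfl⟩
        exact hq
      · intro hp
        exact ⟨(⟨p.1, ht p hp⟩, p.2), hp, rfl⟩
  refine h1.trans ?_
  have h2 : #(Finset (S × I)) ≤ max #(S × I) ℵ₀ := by
    rcases finite_or_infinite (S × I) with h | h
    · exact (lt_aleph0_of_finite _).le.trans (le_max_right _ _)
    · rw [mk_finset_of_infinite]
      exact le_max_left _ _
  refine h2.trans (max_le ?_ hI)
  rw [mk_prod, lift_id, lift_id]
  exact (mul_le_mul' hS le_rfl).trans (mul_eq_self hI).le

theorem IsHClosedSpace.exists_adherent {X ι : Type u} [TopologicalSpace X] (hX : IsHClosedSpace X)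
    [Nonempty ι] [SemilatticeSup ι] (O : ι → Set X) (hO : ∀ i, IsOpen (O i))
    (hne : ∀ i, (O i).Nonempty) (hanti : Antitone O) : ∃ y, ∀ i, y ∈ closure (O i) := by
  classical
  by_contra! hc
  obtain ⟨𝒱, hsub, hfin, hd⟩ := hX (range fun i => (closure (O i))ᶜ) ⟨by
    rintro _ ⟨i, rfl⟩
    exact isClosed_closure.isOpen_compl, by
    refine eq_univ_of_forall fun y => ?_
    obtain ⟨i, hi⟩ := hc y
    exact ⟨_, ⟨i, rfl⟩, hi⟩⟩
  have hidx : ∀ W : 𝒱, ∃ i, (closure (O i))ᶜ = W.1 := fun W => hsub W.2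
  choose idx hidx using hidx
  have : Finite 𝒱 := hfin
  obtain ⟨m, hm⟩ := Finite.exists_le idx
  obtain ⟨z, hzO, W, hW, hzW⟩ := hd.inter_open_nonempty _ (hO m) (hne m)
  exact (hidx ⟨W, hW⟩ ▸ hzW : z ∈ (closure (O (idx ⟨W, hW⟩)))ᶜ) (subset_closure (hanti (hm ⟨W, hW⟩) hzO))

/-- The Dow–Porter bound, for a space whose points have `κ` open neighborhoods forming
neighborhood bases in the semiregularization. -/
theorem IsHClosedSpace.mk_le_two_power_of_nhds {X I : Type u} [TopologicalSpace X] [T2Space X]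
    [Infinite I] (hX : IsHClosedSpace X) (V : X → I → Set X) (hVo : ∀ x i, IsOpen (V x i))
    (hVm : ∀ x i, x ∈ V x i)
    (hV : ∀ x (G : Set X), IsOpen G → x ∉ closure G → ∃ i, Disjoint (V x i) G) :
    #X ≤ 2 ^ #I := by
  classical
  have hI : ℵ₀ ≤ #I := aleph0_le_mk I
  rcases isEmpty_or_nonempty X with hem | hne
  · simp
  have hsep : ∀ {x p : X}, x ≠ p → ∃ i, p ∉ closure (V x i) := by
    intro x p hxp
    obtain ⟨A, B, hA, hB, hxA, hpB, hAB⟩ := t2_separation hxp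
    obtain ⟨i, hi⟩ := hV x B hB fun h => by
      obtain ⟨z, hz⟩ := mem_closure_iff.1 h A hA hxA
      exact hAB.le_bot hz
    refine ⟨i, fun h => ?_⟩
    obtain ⟨z, hz⟩ := mem_closure_iff.1 h B hB hpB
    exact hi.le_bot hz.symm
  let inters : Finset (X × I) → Set X := fun t => ⋂ p ∈ t, V p.1 p.2
  let unions : Finset (X × I) → Set X := fun t => ⋃ p ∈ t, V p.1 p.2
  have hio : ∀ t, IsOpen (inters t) := fun t => isOpen_biInter_finset fun p _ => hVo _ _
  have huo : ∀ t, IsOpen (unions t) := fun t => isOpen_biUnion fun p _ => hVo _ _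
  have hadh : ∀ B : Finset I → Finset (X × I), ∃ y, (∀ F, (inters (B F)).Nonempty) →
      ∀ F, y ∈ closure (⋃ F' ≥ F, inters (B F')) := by
    intro B
    by_cases hB : ∀ F, (inters (B F)).Nonempty
    · obtain ⟨y, hy⟩ := hX.exists_adherent (fun F => ⋃ F' ≥ F, inters (B F'))
        (fun F => isOpen_biUnion fun F' _ => hio _)
        (fun F => (hB F).mono fun z hz => mem_biUnion (x := F) le_rfl hz)
        (fun F₁ F₂ h => biUnion_subset_biUnion_left fun F' h' => le_trans h h')
      exact ⟨y, fun _ => hy⟩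
    · exact ⟨Classical.arbitrary X, fun h => absurd h hB⟩
  choose adh hadh using hadh
  have hout : ∀ t : Finset (X × I), ∃ q, (∃ q, q ∉ closure (unions t)) →
      q ∉ closure (unions t) := by
    intro t
    by_cases h : ∃ q, q ∉ closure (unions t)
    · exact ⟨h.choose, fun _ => h.choose_spec⟩
    · exact ⟨Classical.arbitrary X, fun h' => absurd h' h⟩
  choose out hout using hout
  let Fam : Set X → Type u := fun S : Set X => {t : Finset (X × I) // ∀ p ∈ t, p.1 ∈ S}
  obtain ⟨H, hHne, hHcard, hH⟩ := exists_mk_le_two_power_closed (I := I)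
    (fun S => range (fun B : Finset I → Fam S => adh fun F => (B F).1) ∪
      range (fun t : Fam S => out t.1)) (by
    intro S hS
    have hF : #(Fam S) ≤ #I := mk_finset_prod_fst_mem_le hS
    have hinf : ℵ₀ ≤ (2 : Cardinal.{u}) ^ #I := hI.trans (cantor _).le
    refine (mk_union_le _ _).trans ((add_le_add mk_range_le mk_range_le).trans ?_)
    refine (add_le_add (?_ : _ ≤ (2 : Cardinal.{u}) ^ #I) (hF.trans (cantor _).le)).trans
      (add_eq_self hinf).le
    rw [← power_def, mk_finset_of_infinite, ← power_self_eq hI]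
    exact power_le_power_right hF)
  have hHadh : ∀ B : Finset I → Finset (X × I), (∀ F, ∀ p ∈ B F, p.1 ∈ H) → adh B ∈ H := by
    intro B hB
    let S : Set X := insert hHne.some (⋃ F, Prod.fst '' (B F : Set (X × I)))
    refine hH S ?_ ⟨_, mem_insert _ _⟩ ?_ (Or.inl ⟨fun F => ⟨B F, fun p hp =>
      mem_insert_of_mem _ (mem_iUnion.2 ⟨F, p, hp, rfl⟩)⟩, rfl⟩)
    · refine insert_subset hHne.some_mem (iUnion_subset fun F => ?_)
      rintro _ ⟨p, hp, rfl⟩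
      exact hB F p hp
    · refine mk_insert_le.trans (add_le_of_le hI ?_ (one_le_aleph0.trans hI))
      refine (mk_iUnion_le _).trans ?_
      rw [mk_finset_of_infinite]
      refine (mul_le_mul' le_rfl (ciSup_le' fun F => ?_)).trans (mul_eq_self hI).le
      exact (((B F).finite_toSet.image _).lt_aleph0.le).trans hI
  have hHout : ∀ t : Finset (X × I), (∀ p ∈ t, p.1 ∈ H) → out t ∈ H := by
    intro t ht
    let S : Set X := insert hHne.some (Prod.fst '' (t : Set (X × I)))
    refine hH S ?_ ⟨_, mem_insert _ _⟩ ?_ (Or.inr ⟨⟨t, fun p hp =>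
      mem_insert_of_mem _ ⟨p, hp, rfl⟩⟩, rfl⟩)
    · refine insert_subset hHne.some_mem ?_
      rintro _ ⟨p, hp, rfl⟩
      exact ht p hp
    · exact (((t.finite_toSet.image _).insert _).lt_aleph0.le).trans hI
  suffices hall : ∀ p, p ∈ H by
    rw [← mk_univ, ← eq_univ_of_forall hall]
    exact hHcard
  intro p
  by_contra hp
  have hcov : ∀ x : X, ∃ i, x ∈ H → p ∉ closure (V x i) := by
    intro x
    by_cases hx : x ∈ H
    · obtain ⟨i, hi⟩ := hsep (x := x) (p := p) (fun h => hp (h ▸ hx))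
      exact ⟨i, fun _ => hi⟩
    · exact ⟨Classical.arbitrary I, fun h => absurd h hx⟩
  choose c hc using hcov
  let large : Set X → Prop := fun G =>
    ∀ t : Finset (X × I), (∀ p ∈ t, p.1 ∈ H) → (inters t).Nonempty → (inters t ∩ G).Nonempty
  let good : Set (Set (Set X)) := {𝒲 | (∀ W ∈ 𝒲, IsOpen W) ∧
    ∀ 𝒱 ⊆ 𝒲, 𝒱.Finite → ¬ large (⋃₀ 𝒱)}
  have hstart : (fun x => V x (c x)) '' H ∈ good := by
    refine ⟨by rintro _ ⟨x, -, rfl⟩; exact hVo _ _, fun 𝒱 h𝒱 hfin hl => ?_⟩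
    obtain ⟨s, hsH, hsfin, rfl⟩ := exists_subset_image_finite_and.1 ⟨𝒱, h𝒱, hfin, rfl⟩
    let t : Finset (X × I) := hsfin.toFinset.image fun x => (x, c x)
    have htH : ∀ q ∈ t, q.1 ∈ H := by
      intro q hq
      obtain ⟨x, hx, rfl⟩ := Finset.mem_image.1 hq
      exact hsH (hsfin.mem_toFinset.1 hx)
    have htu : unions t = ⋃₀ ((fun x => V x (c x)) '' s) := by
      ext z
      simp [unions, t]
    have hpt : p ∉ closure (unions t) := by
      rw [htu, (hsfin.image _).closure_sUnion]
      simp only [mem_iUnion, not_exists]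
      rintro _ ⟨x, hx, rfl⟩
      exact hc x (hsH hx)
    obtain ⟨j, hj⟩ := hV _ _ (huo t) (hout t ⟨p, hpt⟩)
    obtain ⟨z, hz1, hz2⟩ := hl {(out t, j)} (by simpa using hHout t htH)
      ⟨out t, by simpa [inters] using hVm _ _⟩
    rw [← htu] at hz2
    exact hj.le_bot ⟨by simpa [inters] using hz1, hz2⟩
  obtain ⟨𝒲, hle, hmax⟩ := zorn_subset_nonempty good (by
    intro C hC hchain hCne
    refine ⟨⋃₀ C, ⟨?_, ?_⟩, fun s hs => subset_sUnion_of_mem hs⟩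
    · rintro W ⟨s, hs, hW⟩
      exact (hC hs).1 W hW
    · intro 𝒱 h𝒱 hfin
      obtain ⟨s, hs, h𝒱s⟩ := hchain.directedOn.exists_mem_subset_of_finite_of_subset_sUnion
        hCne hfin h𝒱
      exact (hC hs).2 𝒱 h𝒱s hfin) _ hstart
  have hgood : 𝒲 ∈ good := hmax.prop
  have hncov : ⋃₀ 𝒲 ≠ Set.univ := by
    intro h
    obtain ⟨𝒱, hsub, hfin, hd⟩ := hX 𝒲 ⟨hgood.1, h⟩
    exact hgood.2 𝒱 hsub hfin fun t _ ht => hd.inter_open_nonempty _ (hio t) ht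
  obtain ⟨r, hr⟩ := (ne_univ_iff_exists_notMem _).1 hncov
  have hrH : r ∉ H := fun h => hr ⟨_, hle ⟨r, h, rfl⟩, hVm _ _⟩
  have hext : ∀ i, ∃ 𝒱 ⊆ 𝒲, 𝒱.Finite ∧ large (V r i ∪ ⋃₀ 𝒱) := by
    intro i
    by_contra! hcon
    have hmem : insert (V r i) 𝒲 ∈ good := by
      refine ⟨?_, fun 𝒱 h𝒱 hfin hl => ?_⟩
      · rintro W (rfl | hW)
        · exact hVo _ _
        · exact hgood.1 W hW
      · refine hcon (𝒱 \ {V r i}) ?_ (hfin.subset sdiff_subset) ?_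
        · rintro W ⟨hW, hne⟩
          exact (h𝒱 hW).resolve_left hne
        · intro t ht htne
          refine (hl t ht htne).mono (inter_subset_inter_right _ ?_)
          rintro z ⟨W, hW, hz⟩
          by_cases hWr : W = V r i
          · exact Or.inl (hWr ▸ hz)
          · exact Or.inr ⟨W, ⟨hW, hWr⟩, hz⟩
    exact hr ⟨V r i, hmax.le_of_ge hmem (subset_insert _ _) (mem_insert _ _), hVm _ _⟩
  choose 𝒱 h𝒱sub h𝒱fin h𝒱large using hext
  have hB : ∀ F : Finset I, ∃ t : Finset (X × I), (∀ p ∈ t, p.1 ∈ H) ∧ (inters t).Nonempty ∧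
      Disjoint (inters t) (⋃₀ ⋃ i ∈ F, 𝒱 i) := by
    intro F
    have := hgood.2 (⋃ i ∈ F, 𝒱 i) (iUnion₂_subset fun i _ => h𝒱sub i)
      (F.finite_toSet.biUnion fun i _ => h𝒱fin i)
    simp only [large, not_forall] at this
    obtain ⟨t, h1, h2, h3⟩ := this
    exact ⟨t, h1, h2, disjoint_iff_inter_eq_empty.2 (not_nonempty_iff_eq_empty.1 h3)⟩
  choose B hBH hBne hBd using hB
  have hyH : adh B ∈ H := hHadh B hBH
  have hy := hadh B hBne
  set y := adh B with hydef
  obtain ⟨i, hi⟩ := hsep (x := r) (p := y) (fun h => hrH (h ▸ hyH))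
  obtain ⟨j, hj⟩ := hV y _ (hVo r i) hi
  obtain ⟨z, hzN, hzB⟩ := mem_closure_iff.1 (hy {i}) _ (hVo y j) (hVm y j)
  simp only [mem_iUnion] at hzB
  obtain ⟨F, hF, hzB⟩ := hzB
  have hins : inters (insert (y, j) (B F)) = V y j ∩ inters (B F) := by
    simp [inters]
  obtain ⟨w, hw1, hw2⟩ := h𝒱large i (insert (y, j) (B F)) (by
    intro q hq
    rcases Finset.mem_insert.1 hq with rfl | hq
    · exact hyH
    · exact hBH F q hq) ⟨z, by rw [hins]; exact ⟨hzN, hzB⟩⟩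
  rw [hins] at hw1
  rcases hw2 with hw2 | ⟨W, hW, hw2⟩
  · exact hj.le_bot ⟨hw1.1, hw2⟩
  · exact (hBd F).le_bot ⟨hw1.2, W, mem_biUnion (hF (Finset.mem_singleton_self i)) hW, hw2⟩

/-- The Dow–Porter bound for an indexed family of neighborhoods witnessing the closed
pseudocharacter. -/
theorem IsHClosedSpace.mk_le_two_power {X I : Type u} [TopologicalSpace X] [T2Space X]
    [Infinite I] (hX : IsHClosedSpace X) (V : X → I → Set X) (hVo : ∀ x i, IsOpen (V x i))
    (hVm : ∀ x i, x ∈ V x i) (hV : ∀ x, (⋂ i, closure (V x i)) = {x}) : #X ≤ 2 ^ #I := by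
  classical
  rw [← mk_finset_of_infinite I]
  refine hX.mk_le_two_power_of_nhds (fun x (F : Finset I) => ⋂ i ∈ F, V x i)
    (fun x F => isOpen_biInter_finset fun i _ => hVo x i)
    (fun x F => mem_iInter₂.2 fun i _ => hVm x i) ?_
  intro x G hG hxG
  obtain ⟨𝒱, hsub, hfin, hd⟩ := hX (insert (closure G)ᶜ (range fun i => (closure (V x i))ᶜ)) ⟨by
    rintro _ (rfl | ⟨i, rfl⟩) <;> exact isClosed_closure.isOpen_compl, by
    refine eq_univ_of_forall fun y => ?_
    by_cases hy : y = x
    · exact ⟨_, mem_insert _ _, hy ▸ hxG⟩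
    · have : y ∉ ⋂ i, closure (V x i) := by rw [hV]; exact hy
      simp only [mem_iInter, not_forall] at this
      obtain ⟨i, hi⟩ := this
      exact ⟨_, mem_insert_of_mem _ ⟨i, rfl⟩, hi⟩⟩
  have hidx : ∀ W : 𝒱, ∃ i, W.1 = (closure G)ᶜ ∨ W.1 = (closure (V x i))ᶜ := by
    rintro ⟨W, hW⟩
    rcases hsub hW with rfl | ⟨i, rfl⟩
    · exact ⟨Classical.arbitrary I, Or.inl rfl⟩
    · exact ⟨i, Or.inr rfl⟩
  choose idx hidx using hidx
  have : Finite 𝒱 := hfin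
  refine ⟨(finite_range idx).toFinset, disjoint_iff_inter_eq_empty.2 ?_⟩
  by_contra hne
  obtain ⟨z, ⟨hzV, hzG⟩, W, hW, hzW⟩ := hd.inter_open_nonempty _
    ((isOpen_biInter_finset fun i _ => hVo x i).inter hG) (nonempty_iff_ne_empty.2 hne)
  rcases hidx ⟨W, hW⟩ with h | h
  · exact (h ▸ hzW : z ∈ (closure G)ᶜ) (subset_closure hzG)
  · refine (h ▸ hzW : z ∈ (closure (V x (idx ⟨W, hW⟩)))ᶜ) (subset_closure ?_)
    exact mem_iInter₂.1 hzV _ (by simp)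

theorem closedPseudoChar_spec (X : Type u) [TopologicalSpace X] [T2Space X] :
    ℵ₀ ≤ closedPseudoChar X ∧ ∀ x : X, ∃ 𝒱 : Set (Set X), #𝒱 ≤ closedPseudoChar X ∧
      (∀ V ∈ 𝒱, IsOpen V ∧ x ∈ V) ∧ (⋂ V ∈ 𝒱, closure V) = {x} := by
  refine csInf_mem (s := {κ | ℵ₀ ≤ κ ∧ ∀ x : X, ∃ 𝒱 : Set (Set X), #𝒱 ≤ κ ∧
    (∀ V ∈ 𝒱, IsOpen V ∧ x ∈ V) ∧ (⋂ V ∈ 𝒱, closure V) = {x}})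
    ⟨max ℵ₀ #(Set X), le_max_left _ _, fun x => ?_⟩
  refine ⟨{V | IsOpen V ∧ x ∈ V}, (mk_set_le _).trans (le_max_right _ _), fun V hV => hV, ?_⟩
  refine Subset.antisymm (fun y hy => ?_)
    (singleton_subset_iff.2 <| mem_iInter₂.2 fun V hV => subset_closure hV.2)
  by_contra hne
  obtain ⟨A, B, hA, hB, hyA, hxB, hAB⟩ := t2_separation (show y ≠ x from hne)
  obtain ⟨z, hz⟩ := mem_closure_iff.1 (mem_iInter₂.1 hy B ⟨hB, hxB⟩) A hA hyA
  exact hAB.le_bot hz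

theorem tightness_spec (X : Type u) [TopologicalSpace X] :
    ℵ₀ ≤ tightness X ∧ ∀ (A : Set X) (x : X), x ∈ closure A →
      ∃ B ⊆ A, #B ≤ tightness X ∧ x ∈ closure B :=
  csInf_mem (s := {κ | ℵ₀ ≤ κ ∧ ∀ (A : Set X) (x : X), x ∈ closure A →
    ∃ B ⊆ A, #B ≤ κ ∧ x ∈ closure B})
    ⟨max ℵ₀ #X, le_max_left _ _, fun A _ hx =>
      ⟨A, Subset.rfl, (mk_set_le _).trans (le_max_right _ _), hx⟩⟩

theorem wLdeg_spec (X : Type u) [TopologicalSpace X] :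
    ℵ₀ ≤ wLdeg X ∧ ∀ 𝒰 : Set (Set X), IsOpenCover X 𝒰 →
      ∃ 𝒱 ⊆ 𝒰, #𝒱 ≤ wLdeg X ∧ Dense (⋃₀ 𝒱) :=
  csInf_mem (s := {κ | ℵ₀ ≤ κ ∧ ∀ 𝒰 : Set (Set X), IsOpenCover X 𝒰 →
    ∃ 𝒱 ⊆ 𝒰, #𝒱 ≤ κ ∧ Dense (⋃₀ 𝒱)})
    ⟨max ℵ₀ #(Set X), le_max_left _ _, fun 𝒰 h𝒰 =>
      ⟨𝒰, Subset.rfl, (mk_set_le _).trans (le_max_right _ _), by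
        rw [h𝒰.2]; exact dense_univ⟩⟩

theorem exists_indexed_nhds_closedPseudoChar (X : Type u) [TopologicalSpace X] [T2Space X] :
    ∃ V : X → (closedPseudoChar X).out → Set X, (∀ x i, IsOpen (V x i)) ∧ (∀ x i, x ∈ V x i) ∧
      ∀ x, (⋂ i, closure (V x i)) = {x} := by
  obtain ⟨hinf, h⟩ := closedPseudoChar_spec X
  have : ∀ x : X, ∃ V : (closedPseudoChar X).out → Set X, (∀ i, IsOpen (V i)) ∧
      (∀ i, x ∈ V i) ∧ (⋂ i, closure (V i)) = {x} := by
    intro x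
    obtain ⟨𝒱, hcard, h𝒱, hinter⟩ := h x
    obtain ⟨V, hV⟩ := exists_range_eq_of_mk_le (J := (closedPseudoChar X).out)
      (S := insert Set.univ 𝒱) (insert_nonempty _ _) (by
        rw [mk_out]
        exact mk_insert_le.trans (add_le_of_le hinf hcard (one_le_aleph0.trans hinf)))
    have hmem : ∀ i, V i ∈ insert Set.univ 𝒱 := fun i => hV ▸ mem_range_self i
    refine ⟨V, fun i => ?_, fun i => ?_, ?_⟩
    · rcases hmem i with hi | hi
      · rw [hi]; exact isOpen_univ
      · exact (h𝒱 _ hi).1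
    · rcases hmem i with hi | hi
      · rw [hi]; exact mem_univ x
      · exact (h𝒱 _ hi).2
    · rw [← biInter_range (f := V) (g := closure), hV, biInter_insert, hinter]
      simp
  choose V h1 h2 h3 using this
  exact ⟨V, h1, h2, h3⟩

theorem mk_le_mk_dense_power (X : Type u) [TopologicalSpace X] [T2Space X] {D : Set X}
    (hD : Dense D) : #X ≤ #D ^ (closedPseudoChar X * tightness X) := by
  obtain ⟨V, hVo, hVm, hV⟩ := exists_indexed_nhds_closedPseudoChar X
  have h : ∀ x, ∃ φ : (closedPseudoChar X).out → (tightness X).out → D,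
      (⋂ i, closure (range fun j => (φ i j : X))) = {x} := by
    intro x
    obtain ⟨B, hBD, hBcard, hxB⟩ := (tightness_spec X).2 D x (hD x)
    have hcl : ∀ i, x ∈ closure (V x i ∩ B) := by
      intro i
      rw [mem_closure_iff]
      intro O hO hxO
      obtain ⟨z, ⟨hz1, hz2⟩, hz3⟩ := mem_closure_iff.1 hxB _ (hO.inter (hVo x i)) ⟨hxO, hVm x i⟩
      exact ⟨z, hz1, hz2, hz3⟩
    have hi : ∀ i, ∃ f : (tightness X).out → X, range f = V x i ∩ B := fun i =>
      exists_range_eq_of_mk_le (closure_nonempty_iff.1 ⟨x, hcl i⟩) (by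
        rw [mk_out]
        exact (mk_le_mk_of_subset inter_subset_right).trans hBcard)
    choose f hf using hi
    refine ⟨fun i j => ⟨f i j, hBD (hf i ▸ mem_range_self j : f i j ∈ V x i ∩ B).2⟩, ?_⟩
    refine Subset.antisymm ?_ (singleton_subset_iff.2 <| mem_iInter.2 fun i => ?_)
    · rw [← hV x]
      refine iInter_mono fun i => closure_mono ?_
      change range (f i) ⊆ _
      rw [hf i]
      exact inter_subset_left
    · change x ∈ closure (range (f i))
      rw [hf i]
      exact hcl i
  choose φ hφ using h
  have hinj : Function.Injective φ := by
    intro x y hxy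
    have := hφ x
    rw [hxy, hφ y] at this
    exact (singleton_injective this).symm
  refine (mk_le_of_injective hinj).trans ?_
  rw [← power_def, ← power_def, ← power_mul, mk_out, mk_out, mul_comm]

theorem mk_le_two_power_closedPseudoChar_of_isHClosedSpace (X : Type u) [TopologicalSpace X] [T2Space X] {A : Set X}
    (hA : IsHClosedSpace A) : #A ≤ 2 ^ closedPseudoChar X := by
  obtain ⟨V, hVo, hVm, hV⟩ := exists_indexed_nhds_closedPseudoChar X
  have hinf : Infinite (closedPseudoChar X).out := by
    rw [infinite_iff, mk_out]
    exact (closedPseudoChar_spec X).1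
  conv_rhs => rw [← mk_out (closedPseudoChar X)]
  refine hA.mk_le_two_power (fun x i => Subtype.val ⁻¹' V x i)
    (fun x i => (hVo x i).preimage continuous_subtype_val) (fun x i => by exact hVm x i)
    fun x => ?_
  refine Subset.antisymm (fun y hy => ?_)
    (singleton_subset_iff.2 <| mem_iInter.2 fun i =>
      subset_closure (hVm (x : X) i : x ∈ Subtype.val ⁻¹' V x i))
  have : (y : X) ∈ ⋂ i, closure (V x i) := mem_iInter.2 fun i =>
    continuous_subtype_val.closure_preimage_subset _ (mem_iInter.1 hy i)
  rw [hV] at this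
  exact Subtype.ext this

theorem stmt11 (X : Type u) [TopologicalSpace X] [T2Space X]
    (h : ∀ x : X, ∃ U : Set X, IsOpen U ∧ x ∈ U ∧ IsHClosedSpace ↥(closure U)) :
    #X ≤ wLdeg X ^ (closedPseudoChar X * tightness X) := by
  obtain ⟨hw, hwL⟩ := wLdeg_spec X
  obtain ⟨hψ, -⟩ := closedPseudoChar_spec X
  obtain ⟨ht, -⟩ := tightness_spec X
  obtain ⟨𝒱, hsub, hcard, hd⟩ := hwL {U | IsOpen U ∧ IsHClosedSpace ↥(closure U)}
    ⟨fun U hU => hU.1, eq_univ_of_forall fun x => by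
      obtain ⟨U, hU, hxU, hUH⟩ := h x
      exact ⟨U, ⟨hU, hUH⟩, hxU⟩⟩
  have hD : #(⋃₀ 𝒱) ≤ wLdeg X * 2 ^ closedPseudoChar X :=
    (mk_sUnion_le 𝒱).trans <| mul_le_mul' hcard <| ciSup_le' fun U =>
      (mk_le_mk_of_subset subset_closure).trans
        (mk_le_two_power_closedPseudoChar_of_isHClosedSpace X (hsub U.2).2)
  have h2 : (2 : Cardinal.{u}) ≤ wLdeg X := natCast_le_aleph0.trans hw
  have hκ : ℵ₀ ≤ closedPseudoChar X * tightness X := by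
    simpa using mul_le_mul' hψ ht
  have hw0 : wLdeg X ≠ 0 := (aleph0_pos.trans_le hw).ne'
  calc #X ≤ #(⋃₀ 𝒱) ^ (closedPseudoChar X * tightness X) := mk_le_mk_dense_power X hd
    _ ≤ (wLdeg X ^ closedPseudoChar X) ^ (closedPseudoChar X * tightness X) := by
      refine power_le_power_right (hD.trans ?_)
      calc wLdeg X * 2 ^ closedPseudoChar X
          ≤ wLdeg X ^ closedPseudoChar X * wLdeg X ^ closedPseudoChar X :=
            mul_le_mul' (self_le_power _ (one_le_aleph0.trans hψ)) (power_le_power_right h2)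
        _ = wLdeg X ^ closedPseudoChar X := by rw [← power_add, add_eq_self hψ]
    _ = wLdeg X ^ (closedPseudoChar X * tightness X) := by
      rw [← power_mul, ← mul_assoc, mul_eq_self hψ]
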